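/- In the Laplacian gadget, the second-order effective interaction due to V₁ satisfies −E† V₁ G' V₁ E = (1/72)(−28·I₄ + 5·X⊗X + 15·Z⊗Z + 2·X⊗I₂ + 2·I₂⊗X), for any matrix G' with G' = Π₊ G' Π₊ and G'·(Π_c H₀' Π_c)·Π₊ = Π₊. -/

import Mathlib

open Matrix
open scoped Kronecker

noncomputable section

/-- Index type for the Fock space of 9 fermionic modes, `ℂ^512`.
Modes `i1,i2,i3,j1,j2,j3,x,y,z` are labelled `0,…,8` in this order. -/
abbrev Idx := Fin 9 → Bool

abbrev Mat := Matrix Idx Idx ℂ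

/-- Jordan–Wigner annihilation operator `a_k = Z^{⊗(k-1)} ⊗ σ⁻ ⊗ I^{⊗(9-k)}`,
written entrywise in the occupation-number basis (`false` = unoccupied `|0⟩`). -/
def a (k : Fin 9) : Mat :=
  Matrix.of fun s t =>
    if t k = true ∧ s = Function.update t k false then
      (-1 : ℂ) ^ (Finset.univ.filter fun l => l < k ∧ t l = true).card
    else 0

/-- Creation operator `a_k†`. -/
def ad (k : Fin 9) : Mat := (a k)ᴴ

/-- The vacuum state `|vac⟩ = |0⟩^{⊗9}`. -/
def vac : Idx → ℂ := fun t => if t = (fun _ => false) then 1 else 0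

/-- `√3` as a complex number. -/
def s3 : ℂ := (Real.sqrt 3 : ℝ)

/-- The edges of the constraint graph `G_c`:
`{i1,i2},{i2,i3},{i1,i3},{j1,j2},{j2,j3},{j1,j3},{i2,x},{j2,x},{i3,y},{j3,y},{i1,z},{j1,z}`. -/
def edges : Finset (Fin 9 × Fin 9) :=
  {(0,1), (1,2), (0,2), (3,4), (4,5), (3,5), (1,6), (4,6), (2,7), (5,7), (0,8), (3,8)}

/-- Adjacency in the constraint graph `G_c`. -/
def Adj (k l : Fin 9) : Prop := (k, l) ∈ edges ∨ (l, k) ∈ edges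

instance (k l : Fin 9) : Decidable (Adj k l) := by unfold Adj; infer_instance

/-- `S` is an independent set of the constraint graph `G_c`. -/
def IndepSet (S : Finset (Fin 9)) : Prop := ∀ k ∈ S, ∀ l ∈ S, ¬ Adj k l

instance (S : Finset (Fin 9)) : Decidable (IndepSet S) := by unfold IndepSet; infer_instance

/-- The Fock basis state `|S⟩` with exactly the modes in `S` occupied. -/
def fock (S : Finset (Fin 9)) : Idx → ℂ :=
  fun t => if t = (fun k => decide (k ∈ S)) then 1 else 0

/-- The set of occupied modes of an occupation vector. -/
def suppOf (t : Idx) : Finset (Fin 9) := Finset.univ.filter fun k => t k = true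

/-- The two-particle constrained subspace: the span of the Fock states `|S⟩` over
independent sets `S` of `G_c` with `|S| = 2`. -/
def C2 : Submodule ℂ (Idx → ℂ) :=
  Submodule.span ℂ {v | ∃ S : Finset (Fin 9), IndepSet S ∧ S.card = 2 ∧ v = fock S}

/-- `Π_c`, the orthogonal projector onto the two-particle constrained subspace.
Since that subspace is spanned by standard (Fock) basis vectors, the orthogonal
projector is the diagonal 0/1 matrix supported on those coordinates. -/
def Pic : Mat :=
  Matrix.diagonal fun t => if IndepSet (suppOf t) ∧ (suppOf t).card = 2 then 1 else 0

/-- `H_{0,i} = I + (a_{i1}†a_{i2}+h.c.) + (a_{i2}†a_{i3}+h.c.) + (a_{i3}†a_{i1}+h.c.)`. -/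
def H0i : Mat :=
  1 + (ad 0 * a 1 + ad 1 * a 0) + (ad 1 * a 2 + ad 2 * a 1) + (ad 2 * a 0 + ad 0 * a 2)

/-- `H_{0,j}`, defined analogously on modes `j1,j2,j3`. -/
def H0j : Mat :=
  1 + (ad 3 * a 4 + ad 4 * a 3) + (ad 4 * a 5 + ad 5 * a 4) + (ad 5 * a 3 + ad 3 * a 5)

/-- `H₀ = H_{0,i} + H_{0,j}`. -/
def H0 : Mat := H0i + H0j

/-- `S_{·,b}` on modes `k1,k2,k3`:
`S_{·,0} = (1/(2√3))((1−√3)a_{k3}† − 2a_{k1}† + (1+√3)a_{k2}†)` and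
`S_{·,1} = (1/(2√3))((1+√3)a_{k3}† − 2a_{k1}† + (1−√3)a_{k2}†)`. -/
def Senc (k1 k2 k3 : Fin 9) (b : Fin 2) : Mat :=
  if b = 0 then
    (1 / (2 * s3)) • ((1 - s3) • ad k3 - (2 : ℂ) • ad k1 + (1 + s3) • ad k2)
  else
    (1 / (2 * s3)) • ((1 + s3) • ad k3 - (2 : ℂ) • ad k1 + (1 - s3) • ad k2)

/-- The encoded two-qubit state `|bb'⟩_enc = S_{i,b} S_{j,b'} |vac⟩`. -/
def enc (b b' : Fin 2) : Idx → ℂ := (Senc 0 1 2 b * Senc 3 4 5 b').mulVec vac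

/-- The encoding isometry `E : ℂ⁴ → ℂ^512`, sending `|b⟩⊗|b'⟩` to `|bb'⟩_enc`. -/
def Eenc : Matrix Idx (Fin 2 × Fin 2) ℂ := Matrix.of fun t p => enc p.1 p.2 t

/-- `Π₋ = E E†`, the orthogonal projector onto the span of the four encoded states. -/
def Pim : Mat := Eenc * Eencᴴ

/-- `Π₊ = Π_c − Π₋`. -/
def Pip : Mat := Pic - Pim

/-- `V₁ = (a_{i2}†a_x+h.c.) + (a_{j2}†a_x+h.c.) + (a_{i3}†a_y+h.c.) + (a_{j3}†a_y+h.c.)`. -/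
def V1 : Mat :=
  (ad 1 * a 6 + ad 6 * a 1) + (ad 4 * a 6 + ad 6 * a 4)
    + (ad 2 * a 7 + ad 7 * a 2) + (ad 5 * a 7 + ad 7 * a 5)

/-- `V₂ = (a_{i1}†a_z+h.c.) + (a_{j1}†a_z+h.c.)`. -/
def V2 : Mat := (ad 0 * a 8 + ad 8 * a 0) + (ad 3 * a 8 + ad 8 * a 3)

/-- `V_main = V₁ + V₂`. -/
def Vmain : Mat := V1 + V2

/-- The Pauli matrix `X`. -/
def PX : Matrix (Fin 2) (Fin 2) ℂ := !![0, 1; 1, 0]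

/-- The Pauli matrix `Z`. -/
def PZ : Matrix (Fin 2) (Fin 2) ℂ := !![1, 0; 0, -1]

/-- `P_k = ∏_{l : {k,l} ∈ E(G_c)} (I − n_l)`, the product over the neighbours of
`k` in the constraint graph (the factors pairwise commute, so the product is
taken over the neighbours listed in increasing order). -/
def Pk (k : Fin 9) : Mat :=
  ((((Finset.univ.filter fun l => Adj k l)).sort (· ≤ ·)).map
    fun l => (1 : Mat) - ad l * a l).prod

/-- The Laplacian-gadget unperturbed Hamiltonian
`H₀' = (a_{i1}†a_{i2}+h.c.) + (a_{i2}†a_{i3}+h.c.) + (a_{i3}†a_{i1}+h.c.)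
     + (a_{j1}†a_{j2}+h.c.) + (a_{j2}†a_{j3}+h.c.) + (a_{j3}†a_{j1}+h.c.)
     + P_{i1} + P_{i2} + P_{i3} + P_{j1} + P_{j2} + P_{j3}`. -/
def H0' : Mat :=
  (ad 0 * a 1 + ad 1 * a 0) + (ad 1 * a 2 + ad 2 * a 1) + (ad 2 * a 0 + ad 0 * a 2)
    + (ad 3 * a 4 + ad 4 * a 3) + (ad 4 * a 5 + ad 5 * a 4) + (ad 5 * a 3 + ad 3 * a 5)
    + Pk 0 + Pk 1 + Pk 2 + Pk 3 + Pk 4 + Pk 5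

/-!
STATEMENT 15: In the Laplacian gadget, the second-order effective interaction
due to `V₁`: `−E† V₁ G' V₁ E = (1/72)(−28·I₄ + 5·X⊗X + 15·Z⊗Z + 2·X⊗I₂ + 2·I₂⊗X)`
for any `G'` with `G' = Π₊ G' Π₊` and `G' (Π_c H₀' Π_c) Π₊ = Π₊`.
-/

/-- The Jordan-Wigner sign of mode `k` in the occupation vector `t`. -/
def jwSign (k : Fin 9) (t : Idx) : ℂ :=
  (-1 : ℂ) ^ (Finset.univ.filter fun l => l < k ∧ t l = true).card

lemma jwSign_eq_prod (k : Fin 9) (t : Idx) :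
    jwSign k t = ∏ l, if l < k ∧ t l = true then (-1 : ℂ) else 1 := by
  simp [jwSign, Finset.prod_ite]

lemma jwSign_update (k l : Fin 9) (t : Idx) (b : Bool) (h : t l = !b) :
    jwSign k (Function.update t l b) = if l < k then -jwSign k t else jwSign k t := by
  rw [jwSign_eq_prod, jwSign_eq_prod, ← Finset.mul_prod_erase _ _ (Finset.mem_univ l),
    ← Finset.mul_prod_erase Finset.univ (fun i => if i < k ∧ t i = true then (-1 : ℂ) else 1)
      (Finset.mem_univ l)]
  have : ∏ i ∈ Finset.univ.erase l,
        (if i < k ∧ Function.update t l b i = true then (-1 : ℂ) else 1) =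
      ∏ i ∈ Finset.univ.erase l, if i < k ∧ t i = true then (-1 : ℂ) else 1 := by
    refine Finset.prod_congr rfl fun i hi => ?_
    rw [Function.update_of_ne (Finset.ne_of_mem_erase hi)]
  rw [this]
  cases b <;> by_cases hlk : l < k <;> simp [h, hlk]

lemma jwSign_mul_self (k : Fin 9) (t : Idx) : jwSign k t * jwSign k t = 1 := by
  rw [jwSign, ← mul_pow]
  simp

lemma a_mulVec_single (k : Fin 9) (t : Idx) :
    a k *ᵥ Pi.single t 1 =
      if t k = true then jwSign k t • Pi.single (Function.update t k false) 1 else 0 := by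
  ext s
  by_cases h : t k = true <;> simp [a, jwSign, h, Pi.single_apply]

lemma ad_mulVec_single (k : Fin 9) (t : Idx) :
    ad k *ᵥ Pi.single t 1 =
      if t k = true then 0 else jwSign k t • Pi.single (Function.update t k true) 1 := by
  ext s
  have key : (s k = true ∧ t = Function.update s k false) ↔
      (t k = false ∧ s = Function.update t k true) := by
    constructor
    · rintro ⟨h, rfl⟩
      simp [← h]
    · rintro ⟨h, rfl⟩
      simp [← h]
  by_cases h : t k = true
  · have : ¬ (s k = true ∧ t = Function.update s k false) := by
      rw [key]; simp [h]
    simp [ad, a, h, this]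
  · rw [Bool.not_eq_true] at h
    by_cases hs : s = Function.update t k true
    · have hc := key.2 ⟨h, hs⟩
      have := jwSign_update k k t true (by simp [h])
      simp only [lt_irrefl, if_false, ← hs] at this
      rw [jwSign, jwSign] at this
      simp [ad, a, h, hc.1, ← hc.2, ← hs, jwSign, this]
    · have : ¬ (s k = true ∧ t = Function.update s k false) := by
        rw [key]; simp [hs]
      simp [ad, a, h, this, hs]

lemma a_mul_ad_add (p q : Fin 9) :
    a p * ad q + ad q * a p = if p = q then 1 else 0 := by
  refine Matrix.ext_of_mulVec_single fun t => ?_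
  simp only [Matrix.add_mulVec, ← Matrix.mulVec_mulVec, a_mulVec_single, ad_mulVec_single]
  rcases lt_trichotomy p q with h | rfl | h
  · cases hp : t p <;> cases hq : t q <;>
      simp [hp, hq, h.ne, h.ne', h, h.not_gt, a_mulVec_single, ad_mulVec_single, jwSign_update,
        Matrix.mulVec_smul, -Matrix.mulVec_single, Function.update_comm h.ne, smul_smul, mul_comm]
  · cases hp : t p <;>
      simp [hp, a_mulVec_single, ad_mulVec_single, jwSign_update, Matrix.mulVec_smul,
        -Matrix.mulVec_single, smul_smul, jwSign_mul_self] <;> simp [← hp]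
  · cases hp : t p <;> cases hq : t q <;>
      simp [hp, hq, h.ne, h.ne', h, h.not_gt, a_mulVec_single, ad_mulVec_single, jwSign_update,
        Matrix.mulVec_smul, -Matrix.mulVec_single, Function.update_comm h.ne, smul_smul, mul_comm]

lemma ad_mul_ad_add (p q : Fin 9) : ad p * ad q + ad q * ad p = 0 := by
  refine Matrix.ext_of_mulVec_single fun t => ?_
  simp only [Matrix.add_mulVec, ← Matrix.mulVec_mulVec, ad_mulVec_single]
  rcases lt_trichotomy p q with h | rfl | h
  · cases hp : t p <;> cases hq : t q <;>
      simp [hp, hq, h.ne, h.ne', h, h.not_gt, ad_mulVec_single, jwSign_update,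
        Matrix.mulVec_smul, -Matrix.mulVec_single, Function.update_comm h.ne, smul_smul, mul_comm]
  · cases t p <;> simp [ad_mulVec_single, Matrix.mulVec_smul, -Matrix.mulVec_single]
  · cases hp : t p <;> cases hq : t q <;>
      simp [hp, hq, h.ne, h.ne', h, h.not_gt, ad_mulVec_single, jwSign_update,
        Matrix.mulVec_smul, -Matrix.mulVec_single, Function.update_comm h.ne, smul_smul, mul_comm]

lemma vac_eq_single : vac = Pi.single (fun _ => false) 1 := by
  ext t
  simp [vac, Pi.single_apply]

lemma a_mulVec_vac (k : Fin 9) : a k *ᵥ vac = 0 := by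
  rw [vac_eq_single, a_mulVec_single, if_neg (by simp)]

lemma a_mulVec_ad_mulVec (p q : Fin 9) (v : Idx → ℂ) :
    a p *ᵥ (ad q *ᵥ v) = (if p = q then v else 0) - ad q *ᵥ (a p *ᵥ v) := by
  have h := congrArg (· *ᵥ v) (a_mul_ad_add p q)
  simp only [Matrix.add_mulVec, ← Matrix.mulVec_mulVec] at h
  rw [eq_sub_iff_add_eq, h]
  split_ifs <;> simp

/-- The two-particle state `a_p† a_q† |vac⟩`. -/
def ket (p q : Fin 9) : Idx → ℂ := ad p *ᵥ (ad q *ᵥ vac)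

lemma ket_swap (p q : Fin 9) : ket p q = -ket q p := by
  have h := congrArg (· *ᵥ vac) (ad_mul_ad_add p q)
  simp only [Matrix.add_mulVec, ← Matrix.mulVec_mulVec, Matrix.zero_mulVec] at h
  exact eq_neg_of_add_eq_zero_left h

lemma ket_self (p : Fin 9) : ket p p = 0 :=
  self_eq_neg.mp (ket_swap p p)

lemma a_mulVec_ket (q r s : Fin 9) :
    a q *ᵥ ket r s =
      (if q = r then ad s *ᵥ vac else 0) - if q = s then ad r *ᵥ vac else 0 := by
  simp only [ket, a_mulVec_ad_mulVec, a_mulVec_vac, Matrix.mulVec_zero, sub_zero]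
  split_ifs <;> simp

lemma ad_mul_a_mulVec_ket (p q r s : Fin 9) :
    (ad p * a q) *ᵥ ket r s =
      (if q = r then ket p s else 0) + if q = s then ket r p else 0 := by
  rw [← Matrix.mulVec_mulVec, a_mulVec_ket, Matrix.mulVec_sub, ket_swap r p, sub_eq_add_neg]
  split_ifs <;> simp [ket]

lemma one_sub_number_mulVec_ket (l r s : Fin 9) :
    (1 - ad l * a l) *ᵥ ket r s = if l = r ∨ l = s then 0 else ket r s := by
  rw [Matrix.sub_mulVec, Matrix.one_mulVec, ad_mul_a_mulVec_ket]
  by_cases hr : l = r <;> by_cases hs : l = s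
  · subst hr; subst hs; simp [ket_self]
  · subst hr; simp [hs]
  · subst hs; simp [hr]
  · simp [hr, hs]

lemma prod_one_sub_number_mulVec_ket (L : List (Fin 9)) (r s : Fin 9) :
    (L.map fun l => (1 : Mat) - ad l * a l).prod *ᵥ ket r s =
      if r ∈ L ∨ s ∈ L then 0 else ket r s := by
  induction L with
  | nil => simp
  | cons l L ih =>
    rw [List.map_cons, List.prod_cons, ← Matrix.mulVec_mulVec, ih]
    by_cases h : r ∈ L ∨ s ∈ L
    · have : r ∈ l :: L ∨ s ∈ l :: L := by simp only [List.mem_cons]; tauto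
      simp only [if_pos h, if_pos this, Matrix.mulVec_zero]
    · rw [if_neg h, one_sub_number_mulVec_ket]
      refine if_congr ?_ rfl rfl
      simp only [List.mem_cons]
      rw [eq_comm (a := l), eq_comm (a := l)]
      tauto

lemma Pk_mulVec_ket (k r s : Fin 9) :
    Pk k *ᵥ ket r s = if Adj k r ∨ Adj k s then 0 else ket r s := by
  simp [Pk, prod_one_sub_number_mulVec_ket]

lemma Pic_mulVec_ket (r s : Fin 9) :
    Pic *ᵥ ket r s = if IndepSet {r, s} then ket r s else 0 := by
  by_cases h : r = s
  · subst h; simp [ket_self]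
  · have hsupp : suppOf (Function.update (Function.update (fun _ => false) s true) r true) =
        {r, s} := by
      ext k
      simp only [suppOf, Finset.mem_filter, Function.update_apply]
      by_cases hr : k = r <;> by_cases hs : k = s <;> simp [hr, hs]
    have hPic : ∀ t, Pic *ᵥ Pi.single t 1 =
        if IndepSet (suppOf t) ∧ (suppOf t).card = 2 then Pi.single t 1 else 0 := by
      intro t
      rw [Pic, Matrix.diagonal_mulVec_single]
      split_ifs <;> simp
    simp only [ket, vac_eq_single, ad_mulVec_single]
    simp [h, Matrix.mulVec_smul, ad_mulVec_single, hPic, hsupp,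
      Finset.card_pair h, -Matrix.mulVec_single]

lemma star_ket_dotProduct_ket (p q r s : Fin 9) :
    star (ket p q) ⬝ᵥ ket r s =
      (if p = r ∧ q = s then 1 else 0) - if p = s ∧ q = r then 1 else 0 := by
  have hadj : ∀ (k : Fin 9) (v w : Idx → ℂ), star (ad k *ᵥ v) ⬝ᵥ w = star v ⬝ᵥ (a k *ᵥ w) := by
    intro k v w
    rw [Matrix.star_mulVec, ← Matrix.dotProduct_mulVec, ad, Matrix.conjTranspose_conjTranspose]
  have hvac : star vac ⬝ᵥ vac = 1 := by simp [vac_eq_single]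
  have hone : ∀ k l, star vac ⬝ᵥ (a k *ᵥ (ad l *ᵥ vac)) = if k = l then 1 else 0 := by
    intro k l
    rw [a_mulVec_ad_mulVec, a_mulVec_vac, Matrix.mulVec_zero, sub_zero]
    split_ifs <;> simp [hvac]
  have hite : ∀ (P : Prop) [Decidable P] (k l : Fin 9),
      star vac ⬝ᵥ (a k *ᵥ (if P then ad l *ᵥ vac else 0)) = if P ∧ k = l then 1 else 0 := by
    intro P _ k l
    by_cases hP : P
    · rw [if_pos hP, hone]
      simp [hP]
    · simp [hP]
  rw [ket, hadj, hadj, a_mulVec_ket, Matrix.mulVec_sub, dotProduct_sub, hite, hite]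

/-- The coefficients of `Senc` on its three modes. -/
def amp (b : Fin 2) : Fin 3 → ℂ :=
  if b = 0 then ![-2 / (2 * s3), (1 + s3) / (2 * s3), (1 - s3) / (2 * s3)]
  else ![-2 / (2 * s3), (1 - s3) / (2 * s3), (1 + s3) / (2 * s3)]

/-- The product state of a particle on `i` with coefficients `c` and one on `j` with
coefficients `d`. -/
def productState (c d : Fin 3 → ℂ) : Idx → ℂ :=
  (c 0 * d 0) • ket 0 3 + (c 0 * d 1) • ket 0 4 + (c 0 * d 2) • ket 0 5
    + ((c 1 * d 0) • ket 1 3 + (c 1 * d 1) • ket 1 4 + (c 1 * d 2) • ket 1 5)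
    + ((c 2 * d 0) • ket 2 3 + (c 2 * d 1) • ket 2 4 + (c 2 * d 2) • ket 2 5)

lemma Senc_eq (k1 k2 k3 : Fin 9) (b : Fin 2) :
    Senc k1 k2 k3 b = amp b 0 • ad k1 + amp b 1 • ad k2 + amp b 2 • ad k3 := by
  fin_cases b <;> simp [Senc, amp] <;> module

lemma enc_eq_productState (b b' : Fin 2) : enc b b' = productState (amp b) (amp b') := by
  simp only [enc, Senc_eq, productState, ket, ← Matrix.mulVec_mulVec, Matrix.add_mulVec,
    Matrix.smul_mulVec, Matrix.mulVec_add, Matrix.mulVec_smul]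
  module

/-- The preimage under the constrained Hamiltonian of the excited part of
`V₁ (productState c d)`. -/
def resolventState (c d : Fin 3 → ℂ) : Idx → ℂ :=
  (c 1 * (3 * d 0 - d 2) / 8) • ket 6 3 + (c 1 * (3 * d 2 - d 0) / 8) • ket 6 5
    + ((d 1 * (3 * c 0 - c 2) / 8) • ket 0 6 + (d 1 * (3 * c 2 - c 0) / 8) • ket 2 6)
    + ((c 2 * (3 * d 0 - d 1) / 8) • ket 7 3 + (c 2 * (3 * d 1 - d 0) / 8) • ket 7 4)
    + ((d 2 * (3 * c 0 - c 1) / 8) • ket 0 7 + (d 2 * (3 * c 1 - c 0) / 8) • ket 1 7)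

lemma indepSet_pair_iff (r s : Fin 9) : IndepSet {r, s} ↔ ¬ Adj r s := by
  have hirr : ∀ k, ¬ Adj k k := by decide
  have hsymm : Adj s r ↔ Adj r s := or_comm
  simp [IndepSet, hirr, hsymm]

lemma Pic_mulVec_V1_mulVec_productState (c d : Fin 3 → ℂ) :
    Pic *ᵥ (V1 *ᵥ productState c d) = Pic *ᵥ (H0' *ᵥ resolventState c d) := by
  simp [V1, H0', productState, resolventState, Matrix.add_mulVec, Matrix.mulVec_add,
    Matrix.mulVec_smul, ad_mul_a_mulVec_ket, Pk_mulVec_ket, Pic_mulVec_ket, indepSet_pair_iff,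
    Adj, edges]
  module

lemma Pic_mulVec_resolventState (c d : Fin 3 → ℂ) :
    Pic *ᵥ resolventState c d = resolventState c d := by
  simp [resolventState, Matrix.mulVec_add, Matrix.mulVec_smul, Pic_mulVec_ket,
    indepSet_pair_iff, Adj, edges]

lemma star_productState_dotProduct_V1_mulVec (f g c d : Fin 3 → ℂ) :
    star (productState f g) ⬝ᵥ (V1 *ᵥ productState c d) = 0 := by
  simp [V1, productState, Matrix.add_mulVec, Matrix.mulVec_add, Matrix.mulVec_smul,
    ad_mul_a_mulVec_ket, star_ket_dotProduct_ket]

lemma star_productState_dotProduct_resolventState (f g c d : Fin 3 → ℂ) :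
    star (productState f g) ⬝ᵥ resolventState c d = 0 := by
  simp [productState, resolventState, star_ket_dotProduct_ket]

lemma star_productState_dotProduct_V1_mulVec_resolventState (f g c d : Fin 3 → ℂ) :
    star (productState f g) ⬝ᵥ (V1 *ᵥ resolventState c d) =
      (star (f 1) * c 1 * (star (g 0) * (3 * d 0 - d 2) + star (g 2) * (3 * d 2 - d 0))
        + star (g 1) * d 1 * (star (f 0) * (3 * c 0 - c 2) + star (f 2) * (3 * c 2 - c 0))
        + star (f 2) * c 2 * (star (g 0) * (3 * d 0 - d 1) + star (g 1) * (3 * d 1 - d 0))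
        + star (g 2) * d 2 * (star (f 0) * (3 * c 0 - c 1) + star (f 1) * (3 * c 1 - c 0))) / 8 := by
  simp [V1, productState, resolventState, Matrix.add_mulVec, Matrix.mulVec_add,
    Matrix.mulVec_smul, ad_mul_a_mulVec_ket, star_ket_dotProduct_ket]
  ring

lemma Pip_mulVec (v : Idx → ℂ) (h : ∀ b b', star (enc b b') ⬝ᵥ v = 0) :
    Pip *ᵥ v = Pic *ᵥ v := by
  have hE : Eencᴴ *ᵥ v = 0 := by
    ext p
    exact h p.1 p.2
  rw [Pip, Matrix.sub_mulVec, Pim, ← Matrix.mulVec_mulVec, hE, Matrix.mulVec_zero, sub_zero]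

/-- A generalized inverse of `K` on the range of `P` sends `u` to `w` as soon as `w` lies in the
range of `P` and `K w` is the projection of `u`. -/
lemma mulVec_eq_of_isInverse {n : Type*} [Fintype n] {G P K : Matrix n n ℂ} {u w : n → ℂ}
    (hG : G = P * G * P) (hGinv : G * K * P = P) (hw : P *ᵥ w = w) (hu : P *ᵥ u = K *ᵥ w) :
    G *ᵥ u = w := by
  have h := congrArg (· *ᵥ w) hGinv
  simp only [← Matrix.mulVec_mulVec, hw] at h
  rw [hG, ← Matrix.mulVec_mulVec, ← Matrix.mulVec_mulVec, hu, h, hw]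

lemma star_amp (b : Fin 2) (k : Fin 3) : star (amp b k) = amp b k := by
  have h3 : star s3 = s3 := Complex.conj_ofReal _
  fin_cases b <;> fin_cases k <;> simp [amp, h3]

theorem statement15 (G' : Mat) (hG : G' = Pip * G' * Pip)
    (hGinv : G' * (Pic * H0' * Pic) * Pip = Pip) :
    -(Eencᴴ * V1 * G' * V1 * Eenc) =
      (1 / 72 : ℂ) •
        ((-28 : ℂ) • (1 : Matrix (Fin 2 × Fin 2) (Fin 2 × Fin 2) ℂ)
          + (5 : ℂ) • (PX ⊗ₖ PX) + (15 : ℂ) • (PZ ⊗ₖ PZ)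
          + (2 : ℂ) • (PX ⊗ₖ (1 : Matrix (Fin 2) (Fin 2) ℂ))
          + (2 : ℂ) • ((1 : Matrix (Fin 2) (Fin 2) ℂ) ⊗ₖ PX)) := by
  have hG' : ∀ b b', G' *ᵥ (V1 *ᵥ enc b b') = resolventState (amp b) (amp b') := by
    intro b b'
    rw [enc_eq_productState]
    refine mulVec_eq_of_isInverse hG hGinv ?_ ?_
    · rw [Pip_mulVec, Pic_mulVec_resolventState]
      intro f g
      rw [enc_eq_productState, star_productState_dotProduct_resolventState]
    · rw [Pip_mulVec, Pic_mulVec_V1_mulVec_productState, ← Matrix.mulVec_mulVec,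
        ← Matrix.mulVec_mulVec, Pic_mulVec_resolventState]
      intro f g
      rw [enc_eq_productState, star_productState_dotProduct_V1_mulVec]
  have hentry : ∀ p q : Fin 2 × Fin 2, (Eencᴴ * V1 * G' * V1 * Eenc) p q =
      star (enc p.1 p.2) ⬝ᵥ (V1 *ᵥ resolventState (amp q.1) (amp q.2)) := by
    intro p q
    rw [← hG']
    simp only [Matrix.mul_assoc]
    rfl
  have h3 : s3 ^ 2 = 3 := by
    rw [s3, ← Complex.ofReal_pow, Real.sq_sqrt (by norm_num)]
    norm_num
  have h0 : s3 ≠ 0 := by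
    intro h
    simp [h] at h3
  ext ⟨p, p'⟩ ⟨q, q'⟩
  rw [Matrix.neg_apply, hentry, enc_eq_productState,
    star_productState_dotProduct_V1_mulVec_resolventState]
  simp only [star_amp]
  fin_cases p <;> fin_cases p' <;> fin_cases q <;> fin_cases q' <;>
    simp [amp, PX, PZ] <;> field_simp <;> grind

end
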